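/- Let E be a real inner product space, let a, b, v, u ∈ E with v ≠ 0, and let c, α_V ∈ ℝ. Set n = v/‖v‖, let P u = u − ⟨u, n⟩·n, and define nᵗ = (v + t·u)/‖v + t·u‖ for t near 0 and ψ(n) = c + α_V·(⟨a, b⟩ − ⟨n, a⟩·⟨n, b⟩). Then t ↦ ψ(nᵗ) is differentiable at t = 0 with derivative −(α_V/‖v‖)·(⟨P u, a⟩·⟨n, b⟩ + ⟨n, a⟩·⟨P u, b⟩). -/

import Mathlib

open scoped RealInnerProductSpace

/-- Differentiating the viscothermal integrand `ψ` along the perturbed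
unit normal `nᵗ = (v + t u)/‖v + t u‖`: at `t = 0`, with `n = v/‖v‖` and
`P u = u − ⟪u,n⟫ n`, the derivative is
`−(α_V/‖v‖)(⟪P u, a⟫⟪n, b⟫ + ⟪n, a⟫⟪P u, b⟫)`. -/
theorem stmt_14 {E : Type*} [NormedAddCommGroup E] [InnerProductSpace ℝ E]
    (a b v u : E) (hv : v ≠ 0) (c α_V : ℝ)
    (n Pu : E) (hn : n = ‖v‖⁻¹ • v) (hPu : Pu = u - ⟪u, n⟫ • n) :
    HasDerivAt
      (fun t : ℝ =>
        c + α_V * (⟪a, b⟫ -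
          ⟪‖v + t • u‖⁻¹ • (v + t • u), a⟫ * ⟪‖v + t • u‖⁻¹ • (v + t • u), b⟫))
      (-(α_V / ‖v‖) * (⟪Pu, a⟫ * ⟪n, b⟫ + ⟪n, a⟫ * ⟪Pu, b⟫)) 0 := by
  subst hPu
  subst hn
  have hN : ‖v‖ ≠ 0 := norm_ne_zero_iff.mpr hv
  have hw : HasDerivAt (fun t : ℝ => v + t • u) u 0 := by
    simpa using ((hasDerivAt_id (0 : ℝ)).smul_const u).const_add v
  have hin : ∀ x : E, HasDerivAt (fun t : ℝ => ⟪v + t • u, x⟫) ⟪u, x⟫ 0 := by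
    intro x
    simpa using hw.inner ℝ (hasDerivAt_const (0 : ℝ) x)
  have hq : HasDerivAt (fun t : ℝ => ‖v + t • u‖ ^ 2) (2 * ⟪v, u⟫) 0 := by
    simpa using hw.norm_sq
  have hinv := hq.inv (by simpa using hN)
  have key := (((hinv.mul ((hin a).mul (hin b))).const_sub ⟪a, b⟫).const_mul α_V).const_add c
  refine (key.congr_deriv ?_).congr_of_eventuallyEq (Filter.Eventually.of_forall fun t => ?_)
  · simp only [Pi.mul_apply, Pi.inv_apply, inner_sub_left, real_inner_smul_left,
      real_inner_smul_right, zero_smul, add_zero, real_inner_comm v u]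
    field_simp
    ring
  · simp only [Pi.mul_apply, Pi.inv_apply, real_inner_smul_left, ← inv_pow]
    ring
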